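/- Let μ be a probability measure on (Γ, B(Γ)) admitting correlation functions (k_μ^{(n)})_{n≥1} that satisfy the Ruelle bound with some constant ξ > 0. Let f: ℝ^d → ℝ be measurable, bounded outside some compact set Λ ⊆ ℝ^d, and such that e^f − 1 ∈ L¹(ℝ^d, dx). Then for μ-a.a. γ ∈ Γ one has ⟨|f|,γ⟩ < ∞, and ∫_Γ e^{⟨f,γ⟩} μ(dγ) = 1 + Σ_{n=1}^∞ (1/n!) ∫_{(ℝ^d)^n} (e^{f(x_1)}−1)⋯(e^{f(x_n)}−1) k_μ^{(n)}(x_1,…,x_n) dx_1⋯dx_n, both sides being finite. -/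

import Mathlib

open MeasureTheory Set Filter
open scoped ENNReal NNReal BigOperators Topology Classical

noncomputable section

abbrev EucSp (d : ℕ) := EuclideanSpace ℝ (Fin d)

/-- The configuration space `Γ` over `ℝ^d`: locally finite subsets. -/
def Config (d : ℕ) : Type :=
  {γ : Set (EucSp d) // ∀ Λ : Set (EucSp d), IsCompact Λ → (γ ∩ Λ).Finite}

/-- The σ-algebra on `Γ` generated by the maps `γ ↦ |γ ∩ B|`, `B` Borel. -/
instance Config.instMS (d : ℕ) : MeasurableSpace (Config d) :=
  ⨆ (B : Set (EucSp d)) (_ : MeasurableSet B),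
    MeasurableSpace.comap (fun γ : Config d => (γ.1 ∩ B).encard) (⊤ : MeasurableSpace ℕ∞)

/-- `γ ∪ {x}`. -/
def Config.ins {d : ℕ} (γ : Config d) (x : EucSp d) : Config d :=
  ⟨insert x γ.1, fun Λ hΛ => ((γ.2 Λ hΛ).insert x).subset fun y hy => by
    rcases hy with ⟨h1, h2⟩
    rcases h1 with rfl | h1
    · exact Set.mem_insert _ _
    · exact Set.mem_insert_of_mem _ ⟨h1, h2⟩⟩

/-- `γ ∖ {x}`. -/
def Config.del {d : ℕ} (γ : Config d) (x : EucSp d) : Config d :=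
  ⟨γ.1 \ {x}, fun Λ hΛ => (γ.2 Λ hΛ).subset fun y hy => ⟨hy.1.1, hy.2⟩⟩

/-- The pairing `⟨f, γ⟩ = ∑_{x ∈ γ} f x`. -/
def cpair {d : ℕ} (f : EucSp d → ℝ) (γ : Config d) : ℝ := ∑' x : γ.1, f x.1

/-- `exp : [-∞,∞] → [0,∞]`. -/
def eexp (x : EReal) : ℝ≥0∞ :=
  if x = ⊤ then ⊤ else if x = ⊥ then 0 else ENNReal.ofReal (Real.exp x.toReal)

/-- real-valued exponential of an extended real (with `exp(±∞)` sent to junk value `0`). -/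
def rexp (x : EReal) : ℝ := (eexp x).toReal

/-- The relative energy `E(x,γ) = ∑_{y ∈ γ} φ(x-y)` if absolutely convergent, `+∞` otherwise. -/
def energy {d : ℕ} (φ : EucSp d → EReal) (x : EucSp d) (γ : Set (EucSp d)) : EReal :=
  if (∀ y ∈ γ, φ (x - y) ≠ ⊤) ∧ Summable (fun y : γ => (φ (x - y.1)).toReal)
  then (((∑' y : γ, (φ (x - y.1)).toReal) : ℝ) : EReal)
  else ⊤

/-- `∑_{u ∈ γ} φ(u)` if absolutely convergent, `+∞` otherwise. -/
def totPhi {d : ℕ} (φ : EucSp d → EReal) (γ : Set (EucSp d)) : EReal :=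
  if (∀ y ∈ γ, φ y ≠ ⊤) ∧ Summable (fun y : γ => (φ y.1).toReal)
  then (((∑' y : γ, (φ y.1).toReal) : ℝ) : EReal)
  else ⊤

/-- A pair potential: Borel, even, with `φ(x) ∈ ℝ` off the origin. -/
structure IsPairPotential {d : ℕ} (φ : EucSp d → EReal) : Prop where
  meas : Measurable φ
  even : ∀ x : EucSp d, x ≠ 0 → φ (-x) = φ x
  finite_off : ∀ x : EucSp d, x ≠ 0 → φ x ≠ ⊤
  ne_bot : ∀ x, φ x ≠ ⊥

/-- Stability (S): `∑_{{x,y} ⊆ η} φ(x-y) ≥ -B|η|` for all finite `η`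
(stated with the sum over ordered pairs, which doubles both sides). -/
def Stable {d : ℕ} (φ : EucSp d → EReal) (B : ℝ) : Prop :=
  ∀ η : Finset (EucSp d),
    ((-(2 * B * η.card) : ℝ) : EReal) ≤ ∑ p ∈ η.offDiag, φ (p.1 - p.2)

/-- Low activity–high temperature (LA-HT): `∫ |e^{-φ} - 1| z dx < (2 e^{1+2B})⁻¹`. -/
def LAHT {d : ℕ} (φ : EucSp d → EReal) (z B : ℝ) : Prop :=
  ∫⁻ x : EucSp d, ENNReal.ofReal (|rexp (-(φ x)) - 1| * z)
    < ENNReal.ofReal (2 * Real.exp (1 + 2 * B))⁻¹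

/-- The Georgii–Nguyen–Zessin identity characterizing `μ ∈ G(z,φ)`. -/
def GNZ {d : ℕ} (z : ℝ) (φ : EucSp d → EReal) (μ : Measure (Config d)) : Prop :=
  ∀ F : Config d → EucSp d → ℝ≥0∞,
    Measurable (Function.uncurry F) →
    ∫⁻ γ, ∑' x : γ.1, F γ x.1 ∂μ
      = ∫⁻ γ, ∫⁻ x, ENNReal.ofReal z * eexp (-(energy φ x γ.1)) * F (γ.ins x) x ∂volume ∂μ


/-- Ordered `n`-tuples of distinct points of `γ`. -/
def injTuples {d : ℕ} (n : ℕ) (γ : Set (EucSp d)) : Set (Fin n → EucSp d) :=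
  {p | Function.Injective p ∧ ∀ i, p i ∈ γ}

/-- `(k_μ^{(n)})` is the family of correlation functions of `μ`: each `k n` is measurable,
nonnegative and symmetric, and for every measurable symmetric `f : (ℝ^d)^n → [0,∞]`,
`∫_Γ ∑_{{x_1,…,x_n} ⊆ γ} f dμ = (1/n!) ∫ f·kₙ dx` (stated equivalently via the sum over
ordered tuples of distinct points, which absorbs the factor `1/n!`). -/
def HasCorrFns {d : ℕ} (μ : Measure (Config d)) (k : ∀ n : ℕ, (Fin n → EucSp d) → ℝ) : Prop :=
  (∀ n : ℕ, Measurable (k n) ∧ (∀ x, 0 ≤ k n x) ∧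
      ∀ (σ : Equiv.Perm (Fin n)) (x : Fin n → EucSp d), k n (x ∘ σ) = k n x) ∧
  ∀ n : ℕ, 0 < n → ∀ f : (Fin n → EucSp d) → ℝ≥0∞, Measurable f →
    (∀ (σ : Equiv.Perm (Fin n)) (x : Fin n → EucSp d), f (x ∘ σ) = f x) →
    ∫⁻ γ, ∑' p : injTuples n γ.1, f p.1 ∂μ
      = ∫⁻ x : Fin n → EucSp d, f x * ENNReal.ofReal (k n x)

/-- The Ruelle bound `k^{(n)} ≤ ξⁿ`. -/
def RuelleBound {d : ℕ} (k : ∀ n : ℕ, (Fin n → EucSp d) → ℝ) (ξ : ℝ) : Prop :=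
  ∀ n : ℕ, 0 < n → ∀ x : Fin n → EucSp d, k n x ≤ ξ ^ n

/-- Translation invariance of a family of functions on tuples. -/
def TransInvFns {d : ℕ} (k : ∀ n : ℕ, (Fin n → EucSp d) → ℝ) : Prop :=
  ∀ (n : ℕ) (a : EucSp d) (x : Fin n → EucSp d), k n (fun i => x i + a) = k n x

/-- `P` is a partition of `{0,…,n-1}` into nonempty pairwise disjoint blocks. -/
def IsPartOfUniv {n : ℕ} (P : Finset (Finset (Fin n))) : Prop :=
  (∀ b ∈ P, b.Nonempty) ∧ (P : Set (Finset (Fin n))).PairwiseDisjoint id ∧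
    P.sup id = Finset.univ

/-- `u` is the family of Ursell functions of `k`:
`k(η) = ∑ u(η_1) ⋯ u(η_j)`, summing over all partitions of `η`. -/
def IsUrsell {d : ℕ} (k u : ∀ n : ℕ, (Fin n → EucSp d) → ℝ) : Prop :=
  ∀ n : ℕ, 0 < n → ∀ x : Fin n → EucSp d,
    k n x = ∑ P : Finset (Finset (Fin n)),
      if IsPartOfUniv P then ∏ b ∈ P, u b.card (fun i => x (b.orderIsoOfFin rfl i).1) else 0

/-- `f ∈ C_0(ℝ^d)`: continuous with compact support. -/
def IsC0 {d : ℕ} (f : EucSp d → ℝ) : Prop := Continuous f ∧ HasCompactSupport f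

/-- Cylinder functions `FC_b(C_0(ℝ^d),Γ)`. -/
def Cyl {d : ℕ} (F : Config d → ℝ) : Prop :=
  ∃ (N : ℕ) (f : Fin N → EucSp d → ℝ) (g : (Fin N → ℝ) → ℝ),
    (∀ i, IsC0 (f i)) ∧ Continuous g ∧ (∃ C, ∀ y, |g y| ≤ C) ∧
    ∀ γ, F γ = g fun i => cpair (f i) γ

/-- `(D_x^- F)(γ) = F(γ∖x) - F(γ)`. -/
def Dminus {d : ℕ} (F : Config d → ℝ) (x : EucSp d) (γ : Config d) : ℝ := F (γ.del x) - F γ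

/-- `(D_x^+ F)(γ) = F(γ∪x) - F(γ)`. -/
def Dplus {d : ℕ} (F : Config d → ℝ) (x : EucSp d) (γ : Config d) : ℝ := F (γ.ins x) - F γ

/-- `(D_{xy}^{-+} F)(γ) = F(γ∖x∪y) - F(γ)`. -/
def Dpm {d : ℕ} (F : Config d → ℝ) (x y : EucSp d) (γ : Config d) : ℝ :=
  F ((γ.del x).ins y) - F γ

/-- The Glauber bilinear form `E_G`. -/
def glauberForm {d : ℕ} (s : ℝ) (φ : EucSp d → EReal) (μ : Measure (Config d))
    (F G : Config d → ℝ) : ℝ :=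
  ∫ γ, (∑' x : γ.1,
      rexp ((s : EReal) * energy φ x.1 (γ.1 \ {x.1})) * Dminus F x.1 γ * Dminus G x.1 γ) ∂μ

/-- The Kawasaki bilinear form `E_K`. -/
def kawasakiForm {d : ℕ} (s : ℝ) (a : EucSp d → ℝ) (φ : EucSp d → EReal)
    (μ : Measure (Config d)) (F G : Config d → ℝ) : ℝ :=
  (1 / 2) * ∫ γ, (∑' x : γ.1, ∫ y : EucSp d,
      a (x.1 - y) *
        rexp ((s : EReal) * energy φ x.1 (γ.1 \ {x.1}) +
          ((s - 1 : ℝ) : EReal) * energy φ y (γ.1 \ {x.1})) *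
        Dpm F x.1 y γ * Dpm G x.1 y γ) ∂μ

/-- The Glauber generator `H_G`. -/
def HG {d : ℕ} (s z : ℝ) (φ : EucSp d → EReal) (F : Config d → ℝ) (γ : Config d) : ℝ :=
  -(∑' x : γ.1, rexp ((s : EReal) * energy φ x.1 (γ.1 \ {x.1})) * Dminus F x.1 γ)
    - ∫ x : EucSp d, z * rexp (((s - 1 : ℝ) : EReal) * energy φ x γ.1) * Dplus F x γ

/-- The Kawasaki generator `H_K`. -/
def HK {d : ℕ} (s : ℝ) (a : EucSp d → ℝ) (φ : EucSp d → EReal) (F : Config d → ℝ)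
    (γ : Config d) : ℝ :=
  -(∑' x : γ.1, ∫ y : EucSp d,
      a (x.1 - y) * rexp ((s : EReal) * energy φ x.1 (γ.1 \ {x.1}) +
        ((s - 1 : ℝ) : EReal) * energy φ y (γ.1 \ {x.1})) * Dpm F x.1 y γ)

/-- The scaled jump kernel `a_ε(x) = ε^d a(ε x)`. -/
def aScaled {d : ℕ} (a : EucSp d → ℝ) (ε : ℝ) (x : EucSp d) : ℝ := ε ^ d * a (ε • x)

/-- `H_ε^-` (death part of the Kawasaki generator with kernel `aa`). -/
def HepsMinus {d : ℕ} (s : ℝ) (aa : EucSp d → ℝ) (φ : EucSp d → EReal)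
    (F : Config d → ℝ) (γ : Config d) : ℝ :=
  -(∑' x : γ.1, Dminus F x.1 γ * ∫ y : EucSp d,
      aa (x.1 - y) * rexp ((s : EReal) * energy φ x.1 (γ.1 \ {x.1}) +
        ((s - 1 : ℝ) : EReal) * energy φ y (γ.1 \ {x.1})))

/-- `H_ε^+` (birth part of the Kawasaki generator with kernel `aa`). -/
def HepsPlus {d : ℕ} (s : ℝ) (aa : EucSp d → ℝ) (φ : EucSp d → EReal)
    (F : Config d → ℝ) (γ : Config d) : ℝ :=
  -(∑' x : γ.1, ∫ y : EucSp d,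
      aa (x.1 - y) * rexp ((s : EReal) * energy φ x.1 (γ.1 \ {x.1}) +
        ((s - 1 : ℝ) : EReal) * energy φ y (γ.1 \ {x.1})) * Dplus F y (γ.del x.1))

/-- `H_0^-` (death part of the Glauber generator). -/
def H0Minus {d : ℕ} (s : ℝ) (φ : EucSp d → EReal) (F : Config d → ℝ) (γ : Config d) : ℝ :=
  -(∑' x : γ.1, rexp ((s : EReal) * energy φ x.1 (γ.1 \ {x.1})) * Dminus F x.1 γ)

/-- `H_0^+` (birth part of the Glauber generator). -/
def H0Plus {d : ℕ} (s z : ℝ) (φ : EucSp d → EReal) (F : Config d → ℝ) (γ : Config d) : ℝ :=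
  -∫ x : EucSp d, z * rexp (((s - 1 : ℝ) : EReal) * energy φ x γ.1) * Dplus F x γ

/-- The standing assumptions of the paper: `s ∈ [0,1/2]`, a stable pair potential in the
low activity–high temperature regime, bounded outside a ball, and `μ` the Gibbs measure
from Ruelle's theorem with its correlation and Ursell functions. -/
structure Setting (d : ℕ) (s z B ξ : ℝ) (φ : EucSp d → EReal) (μ : Measure (Config d))
    (k u : ∀ n : ℕ, (Fin n → EucSp d) → ℝ) : Prop where
  hd : 0 < d
  hs0 : 0 ≤ s
  hs1 : s ≤ 1 / 2
  pp : IsPairPotential φ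
  hB : 0 ≤ B
  stable : Stable φ B
  hz : 0 < z
  laht : LAHT φ z B
  bddOutside : ∃ R C : ℝ, ∀ x : EucSp d, R ≤ ‖x‖ → ∃ r : ℝ, φ x = (r : EReal) ∧ |r| ≤ C
  prob : IsProbabilityMeasure μ
  gnz : GNZ z φ μ
  corr : HasCorrFns μ k
  ti : TransInvFns k
  hξ : 0 < ξ
  ruelle : RuelleBound k ξ
  ursell : IsUrsell k u
  ursellInt : ∀ m : ℕ,
    Integrable (fun y : Fin (m + 1) → EucSp d => u (m + 2) (Fin.cons 0 y)) volume

/-- The jump kernel `a`: bounded, nonnegative, even, integrable. -/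
structure GoodA {d : ℕ} (a : EucSp d → ℝ) : Prop where
  meas : Measurable a
  nonneg : ∀ x, 0 ≤ a x
  bdd : ∃ C, ∀ x, a x ≤ C
  even : ∀ x, a (-x) = a x
  int : Integrable a volume

/-- `φ(x) → 0` as `|x| → ∞`. -/
def PhiVanishes {d : ℕ} (φ : EucSp d → EReal) : Prop :=
  Tendsto φ (cocompact (EucSp d)) (nhds (0 : EReal))

/-- The normalization `∫ a dx = (∫_Γ exp[(s-1) ∑_{u∈γ} φ(u)] dμ(γ))⁻¹`. -/
def NormalizedA {d : ℕ} (s : ℝ) (a : EucSp d → ℝ) (φ : EucSp d → EReal)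
    (μ : Measure (Config d)) : Prop :=
  (∫ x : EucSp d, a x) = (∫ γ, rexp (((s - 1 : ℝ) : EReal) * totPhi φ γ.1) ∂μ)⁻¹


/-- The counting measure of a configuration. -/
def Config.countingMeasure {d : ℕ} (γ : Config d) : Measure (EucSp d) :=
  Measure.sum fun x : γ.1 => Measure.dirac x.1

lemma Config.countingMeasure_apply {d : ℕ} (γ : Config d) {B : Set (EucSp d)}
    (hB : MeasurableSet B) : γ.countingMeasure B = ((γ.1 ∩ B).encard : ℝ≥0∞) := by
  rw [Config.countingMeasure, Measure.sum_apply _ hB]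
  simp_rw [Measure.dirac_apply' _ hB]
  rw [tsum_subtype γ.1 (fun x => B.indicator (1 : EucSp d → ℝ≥0∞) x), indicator_indicator]
  rw [← tsum_subtype, ← ENNReal.tsum_set_one]
  rfl

lemma Config.lintegral_countingMeasure {d : ℕ} (γ : Config d) {F : EucSp d → ℝ≥0∞}
    (hF : Measurable F) : ∫⁻ x, F x ∂γ.countingMeasure = ∑' x : γ.1, F x := by
  rw [Config.countingMeasure, lintegral_sum_measure]
  simp_rw [lintegral_dirac' _ hF]

lemma Config.measurable_countingMeasure {d : ℕ} :
    Measurable (Config.countingMeasure : Config d → Measure (EucSp d)) := by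
  refine Measure.measurable_of_measurable_coe _ fun B hB => ?_
  simp_rw [Config.countingMeasure_apply _ hB]
  have h : Measurable[Config.instMS d, ⊤] fun γ : Config d => (γ.1 ∩ B).encard :=
    measurable_iff_comap_le.2 (le_iSup₂_of_le B hB le_rfl)
  exact fun s _ => h (t := {n : ℕ∞ | (n : ℝ≥0∞) ∈ s}) trivial

lemma Config.measurable_tsum {d : ℕ} {α : Type*} [MeasurableSpace α] {c : α → Config d}
    (hc : Measurable c) {F : α → EucSp d → ℝ≥0∞} (hF : Measurable (Function.uncurry F)) :
    Measurable fun a => ∑' x : (c a).1, F a x := by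
  let B : ℕ → Set (EucSp d) := fun i => Metric.closedBall 0 i
  have hB : ∀ i, MeasurableSet (B i) := fun i => Metric.isClosed_closedBall.measurableSet
  have hBmono : Monotone B := fun i j hij =>
    Metric.closedBall_subset_closedBall (by exact_mod_cast hij)
  have hcm : Measurable fun a => (c a).countingMeasure := Config.measurable_countingMeasure.comp hc
  have hev : ∀ i m : ℕ, MeasurableSet {a | (c a).countingMeasure (B i) ≤ m} := fun i m =>
    measurableSet_le ((Measure.measurable_coe (hB i)).comp hcm) measurable_const
  have hres : ∀ i, Measurable fun a => (c a).countingMeasure.restrict (B i) := fun i =>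
    Measure.measurable_of_measurable_coe _ fun s hs => by
      simp_rw [Measure.restrict_apply hs]
      exact (Measure.measurable_coe (hs.inter (hB i))).comp hcm
  let η : ℕ → ℕ → ProbabilityTheory.Kernel α (EucSp d) := fun i m =>
    { toFun := fun a => if (c a).countingMeasure (B i) ≤ m
        then (c a).countingMeasure.restrict (B i) else 0
      measurable' := Measurable.ite (hev i m)
        (hres i) measurable_const }
  have hη : ∀ i m a, η i m a = if (c a).countingMeasure (B i) ≤ m
        then (c a).countingMeasure.restrict (B i) else 0 := fun _ _ _ => rfl
  have hfin : ∀ i m, ProbabilityTheory.IsFiniteKernel (η i m) := fun i m =>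
    ⟨⟨m, ENNReal.natCast_lt_top m, fun a => by
      rw [hη]; split_ifs with h
      · simpa using h
      · simp⟩⟩
  have key : (fun a => ∑' x : (c a).1, F a x) = fun a => ⨆ i, ⨆ m, ∫⁻ x, F a x ∂η i m a := by
    funext a
    have hFa : Measurable (F a) := hF.of_uncurry_left
    rw [← (c a).lintegral_countingMeasure hFa, ← setLIntegral_univ,
      ← Metric.iUnion_closedBall_nat (0 : EucSp d),
      setLIntegral_iUnion_of_directed _ (directed_of_isDirected_le hBmono)]
    refine iSup_congr fun i => le_antisymm ?_ (iSup_le fun m => ?_)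
    · have hlt : (c a).countingMeasure (B i) ≠ ⊤ := by
        have := ((c a).2 (B i) (isCompact_closedBall _ _)).encard_lt_top
        rw [Config.countingMeasure_apply _ (hB i)]
        simpa using this.ne
      obtain ⟨m, hm⟩ := ENNReal.exists_nat_gt hlt
      refine le_iSup_of_le m ?_
      rw [hη, if_pos hm.le]
    · rw [hη]; split_ifs
      · exact le_rfl
      · simp
  rw [key]
  exact Measurable.iSup fun i => Measurable.iSup fun m =>
    Measurable.lintegral_kernel_prod_right hF

lemma Config.measurable_tsum_tuple {d : ℕ} (n : ℕ) : ∀ {α : Type} [MeasurableSpace α]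
    {c : α → Config d}, Measurable c → ∀ {F : α → (Fin n → EucSp d) → ℝ≥0∞},
    Measurable (Function.uncurry F) →
    Measurable fun a => ∑' p : Fin n → (c a).1, F a (fun i => (p i).1) := by
  induction n with
  | zero =>
    intro α _ c hc F hF
    have : (fun a => ∑' p : Fin 0 → (c a).1, F a (fun i => (p i).1)) = fun a => F a default := by
      funext a
      rw [tsum_eq_single default fun b hb => (hb (Subsingleton.elim _ _)).elim]
      congr 1
      exact Subsingleton.elim _ _
    rw [this]
    exact hF.of_uncurry_right
  | succ n ih =>
    intro α _ c hc F hF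
    have hcons : Measurable fun q : EucSp d × (Fin n → EucSp d) =>
        (Fin.cons q.1 q.2 : Fin (n + 1) → EucSp d) := by
      refine measurable_pi_lambda _ fun i => ?_
      refine Fin.cases ?_ (fun j => ?_) i
      · simpa using measurable_fst
      · simpa [Function.comp_def] using (measurable_pi_apply j).comp (measurable_snd (α := EucSp d))
    have h := ih (α := α × EucSp d) (c := fun b => c b.1) (hc.comp measurable_fst)
      (F := fun b q => F b.1 (Fin.cons b.2 q))
      (hF.comp ((measurable_fst.comp measurable_fst).prodMk
        (hcons.comp ((measurable_snd.comp measurable_fst).prodMk measurable_snd))))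
    convert Config.measurable_tsum hc
      (F := fun a x => ∑' p : Fin n → (c a).1, F a (Fin.cons x fun i => (p i).1)) h using 1
    funext a
    rw [← (Fin.consEquiv fun _ => ((c a).1 : Type)).tsum_eq, ENNReal.tsum_prod']
    refine tsum_congr fun x => tsum_congr fun p => ?_
    congr 1
    funext i
    refine Fin.cases ?_ (fun j => ?_) i <;> simp [Fin.consEquiv]

lemma tsum_injTuples {d : ℕ} (n : ℕ) (γ : Set (EucSp d)) (F : (Fin n → EucSp d) → ℝ≥0∞) :
    ∑' p : injTuples n γ, F p = ∑' e : Fin n ↪ γ, F fun i => (e i).1 := by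
  let E : (Fin n ↪ γ) ≃ injTuples n γ :=
    { toFun := fun e => ⟨fun i => (e i).1,
        fun i j h => e.injective (Subtype.ext h), fun i => (e i).2⟩
      invFun := fun p => ⟨fun i => ⟨p.1 i, p.2.2 i⟩, fun i j h => p.2.1 (congrArg Subtype.val h)⟩
      left_inv := fun _ => rfl
      right_inv := fun _ => rfl }
  rw [← E.tsum_eq]
  rfl

lemma measurable_tsum_injTuples {d : ℕ} (n : ℕ) {F : (Fin n → EucSp d) → ℝ≥0∞}
    (hF : Measurable F) : Measurable fun γ : Config d => ∑' p : injTuples n γ.1, F p := by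
  have hI : MeasurableSet {p : Fin n → EucSp d | Function.Injective p} := by
    have : {p : Fin n → EucSp d | Function.Injective p}
        = ⋂ i, ⋂ j, {p | p i = p j → i = j} := by
      ext p; simp [Function.Injective]
    rw [this]
    refine MeasurableSet.iInter fun i => MeasurableSet.iInter fun j => ?_
    by_cases hij : i = j
    · simp [hij]
    · have := (measurableSet_eq_fun (f := fun p : Fin n → EucSp d => p i) (g := fun p => p j)
        (measurable_pi_apply i) (measurable_pi_apply j)).compl
      convert this using 1
      ext p
      simp [hij]
  convert Config.measurable_tsum_tuple n (measurable_id (α := Config d))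
    (F := fun _ => {p : Fin n → EucSp d | Function.Injective p}.indicator F)
    ((hF.indicator hI).comp measurable_snd) using 1
  funext γ
  rw [tsum_injTuples, ← (Equiv.subtypeInjectiveEquivEmbedding (Fin n) γ.1).tsum_eq]
  change _ = ∑' p : Fin n → γ.1,
    {p : Fin n → EucSp d | Function.Injective p}.indicator F fun i => (p i).1
  rw [← tsum_subtype_eq_of_support_subset (s := {p : Fin n → γ.1 | Function.Injective p})]
  · refine tsum_congr fun p => (indicator_of_mem ?_ F).symm
    exact Subtype.val_injective.comp p.2
  · intro p hp
    have := mem_of_indicator_ne_zero hp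
    exact fun i j hij => this (congrArg Subtype.val hij)

lemma ENNReal.tsum_finset_eq_tsum_embedding {ι : Type*} (H : Finset ι → ℝ≥0∞) :
    ∑' s, H s = ∑' n : ℕ, ((n.factorial : ℝ≥0∞))⁻¹ * ∑' e : Fin n ↪ ι, H (Finset.univ.map e) := by
  rw [← (Equiv.sigmaFiberEquiv (Finset.card : Finset ι → ℕ)).tsum_eq, ENNReal.tsum_sigma']
  refine tsum_congr fun n => ?_
  let π : (Fin n ↪ ι) → {s : Finset ι // s.card = n} := fun e => ⟨Finset.univ.map e, by simp⟩
  rw [← (Equiv.sigmaFiberEquiv π).tsum_eq fun e : Fin n ↪ ι => H (Finset.univ.map e),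
    ENNReal.tsum_sigma', ← ENNReal.tsum_mul_left]
  refine tsum_congr fun s => ?_
  have hconst : ∀ e : {e // π e = s}, H (Finset.univ.map e.1) = H s := fun e =>
    congrArg H (congrArg Subtype.val e.2)
  have hcard : ENat.card {e // π e = s} = n.factorial := by
    let E : {e // π e = s} ≃ (Fin n ≃ s.1) :=
      { toFun := fun e => Equiv.ofBijective
          (fun i => ⟨e.1 i, by
            rw [← congrArg Subtype.val e.2]; exact Finset.mem_map_of_mem _ (Finset.mem_univ i)⟩)
          ⟨fun i j h => e.1.injective (congrArg Subtype.val h), fun ⟨x, hx⟩ => by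
            rw [← congrArg Subtype.val e.2] at hx
            obtain ⟨i, -, hi⟩ := Finset.mem_map.1 hx
            exact ⟨i, Subtype.ext hi⟩⟩
        invFun := fun g => ⟨g.toEmbedding.trans (Function.Embedding.subtype _), by
          refine Subtype.ext (Finset.ext fun x => ?_)
          simp only [π, Finset.mem_map, Finset.mem_univ, true_and]
          exact ⟨by rintro ⟨i, rfl⟩; exact (g i).2, fun hx => ⟨g.symm ⟨x, hx⟩, by simp⟩⟩⟩
        left_inv := fun e => by ext; rfl
        right_inv := fun g => by ext; rfl }
    have e0 : Fin n ≃ s.1 := (Finset.equivFinOfCardEq s.2).symm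
    rw [ENat.card_congr E, ENat.card_eq_coe_fintype_card, Fintype.card_equiv e0]
    simp
  have h1 : ∑' e : {e // π e = s}, H (Finset.univ.map e.1) = n.factorial * H s := by
    simp_rw [hconst]
    rw [ENNReal.tsum_const, hcard]
    simp
  change H s = _ * ∑' e : {e // π e = s}, H (Finset.univ.map e.1)
  rw [h1, ← mul_assoc, ENNReal.inv_mul_cancel, one_mul]
  · exact_mod_cast n.factorial_ne_zero
  · exact ENNReal.natCast_ne_top _

lemma tsum_finset_prod_eq {d : ℕ} (γ : Set (EucSp d)) (g : EucSp d → ℝ) (φ : ℝ → ℝ≥0∞) :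
    ∑' s : Finset γ, φ (∏ x ∈ s, g x) = φ 1 + ∑' n : ℕ, (((n + 1).factorial : ℝ≥0∞))⁻¹ *
      ∑' p : injTuples (n + 1) γ, φ (∏ i, g (p.1 i)) := by
  rw [ENNReal.tsum_finset_eq_tsum_embedding, tsum_eq_zero_add' ENNReal.summable]
  congr 1
  · rw [tsum_eq_single Function.Embedding.ofIsEmpty fun e he => (he (by ext i; exact i.elim0)).elim]
    simp
  · refine tsum_congr fun n => ?_
    rw [tsum_injTuples (n + 1) γ fun p => φ (∏ i, g (p i))]
    simp

lemma measurable_comp_prod {d : ℕ} {g : EucSp d → ℝ} (hg : Measurable g) {φ : ℝ → ℝ≥0∞}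
    (hφ : Measurable φ) (n : ℕ) : Measurable fun x : Fin n → EucSp d => φ (∏ i, g (x i)) :=
  hφ.comp (Finset.measurable_prod _ fun i _ => hg.comp (measurable_pi_apply i))

lemma measurable_tsum_finset_prod {d : ℕ} {g : EucSp d → ℝ} (hg : Measurable g) {φ : ℝ → ℝ≥0∞}
    (hφ : Measurable φ) :
    Measurable fun γ : Config d => ∑' s : Finset γ.1, φ (∏ x ∈ s, g x) := by
  simp_rw [tsum_finset_prod_eq]
  exact measurable_const.add (Measurable.tsum fun n =>
    (measurable_tsum_injTuples (n + 1) (measurable_comp_prod hg hφ (n + 1))).const_mul _)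

lemma HasCorrFns.lintegral_tsum_finset_prod {d : ℕ} {μ : Measure (Config d)}
    [IsProbabilityMeasure μ] {k : ∀ n : ℕ, (Fin n → EucSp d) → ℝ} (hk : HasCorrFns μ k)
    {g : EucSp d → ℝ} (hg : Measurable g) {φ : ℝ → ℝ≥0∞} (hφ : Measurable φ) :
    ∫⁻ γ, ∑' s : Finset γ.1, φ (∏ x ∈ s, g x) ∂μ
      = φ 1 + ∑' n : ℕ, (((n + 1).factorial : ℝ≥0∞))⁻¹ *
        ∫⁻ x : Fin (n + 1) → EucSp d, φ (∏ i, g (x i)) * ENNReal.ofReal (k (n + 1) x) := by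
  have hm := fun n : ℕ =>
    measurable_tsum_injTuples (n + 1) (measurable_comp_prod hg hφ (n + 1))
  simp_rw [tsum_finset_prod_eq]
  rw [lintegral_add_left measurable_const, lintegral_const, measure_univ, mul_one,
    lintegral_tsum fun n => ((hm n).const_mul _).aemeasurable]
  congr 1
  refine tsum_congr fun n => ?_
  rw [lintegral_const_mul _ (hm n), hk.2 (n + 1) n.succ_pos _ (measurable_comp_prod hg hφ (n + 1))]
  intro σ x
  exact congrArg φ (Equiv.prod_comp σ fun i => g (x i))

lemma tsum_eq_toReal_tsum_sub {ι : Type*} {h : ι → ℝ} (hs : Summable h) :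
    ∑' i, h i = (∑' i, ENNReal.ofReal (h i)).toReal - (∑' i, ENNReal.ofReal (-h i)).toReal := by
  have h1 : ∑' i, ENNReal.ofReal (h i) ≠ ⊤ := by
    refine ne_top_of_le_ne_top hs.abs.tsum_ofReal_ne_top
      (ENNReal.tsum_le_tsum fun i => ENNReal.ofReal_le_ofReal (le_abs_self _))
  have h2 : ∑' i, ENNReal.ofReal (-h i) ≠ ⊤ := by
    refine ne_top_of_le_ne_top hs.abs.tsum_ofReal_ne_top
      (ENNReal.tsum_le_tsum fun i => ENNReal.ofReal_le_ofReal (neg_le_abs _))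
  rw [ENNReal.tsum_toReal_eq fun _ => ENNReal.ofReal_ne_top,
    ENNReal.tsum_toReal_eq fun _ => ENNReal.ofReal_ne_top,
    ← (ENNReal.summable_toReal h1).tsum_sub (ENNReal.summable_toReal h2)]
  refine tsum_congr fun i => ?_
  rw [ENNReal.toReal_ofReal', ENNReal.toReal_ofReal']
  exact (max_zero_sub_eq_self (h i)).symm

lemma integrable_prod_mul_corr {d : ℕ} {μ : Measure (Config d)}
    {k : ∀ n : ℕ, (Fin n → EucSp d) → ℝ} (hk : HasCorrFns μ k) {ξ : ℝ} (hRB : RuelleBound k ξ)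
    {g : EucSp d → ℝ} (hg : Integrable g) {n : ℕ} (hn : 0 < n) :
    Integrable fun x : Fin n → EucSp d => (∏ i, g (x i)) * k n x :=
  (Integrable.fintype_prod fun _ => hg).mul_bdd (c := ξ ^ n) (hk.1 n).1.aestronglyMeasurable
    (ae_of_all _ fun x => by
      rw [Real.norm_of_nonneg ((hk.1 n).2.1 x)]
      exact hRB n hn x)

lemma lintegral_prod_mul_corr_le {d : ℕ} {μ : Measure (Config d)}
    {k : ∀ n : ℕ, (Fin n → EucSp d) → ℝ} (hk : HasCorrFns μ k) {ξ : ℝ} (hRB : RuelleBound k ξ)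
    {g : EucSp d → ℝ} (hg : Integrable g) {n : ℕ} (hn : 0 < n) :
    ∫⁻ x : Fin n → EucSp d, ‖∏ i, g (x i)‖ₑ * ENNReal.ofReal (k n x)
      ≤ ENNReal.ofReal ((ξ * ∫ x, |g x|) ^ n) := by
  have hprod : Integrable fun x : Fin n → EucSp d => ∏ i, |g (x i)| :=
    Integrable.fintype_prod fun _ => hg.abs
  calc ∫⁻ x : Fin n → EucSp d, ‖∏ i, g (x i)‖ₑ * ENNReal.ofReal (k n x)
      ≤ ∫⁻ x : Fin n → EucSp d, ENNReal.ofReal ((∏ i, |g (x i)|) * ξ ^ n) := by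
        refine lintegral_mono fun x => ?_
        rw [Real.enorm_eq_ofReal_abs, Finset.abs_prod,
          ← ENNReal.ofReal_mul (Finset.prod_nonneg fun _ _ => abs_nonneg _)]
        exact ENNReal.ofReal_le_ofReal (mul_le_mul_of_nonneg_left (hRB n hn x)
          (Finset.prod_nonneg fun _ _ => abs_nonneg _))
    _ = ENNReal.ofReal (∫ x : Fin n → EucSp d, (∏ i, |g (x i)|) * ξ ^ n) := by
        refine (ofReal_integral_eq_lintegral_ofReal (hprod.mul_const _)
          (ae_of_all _ fun x => ?_)).symm
        exact mul_nonneg (Finset.prod_nonneg fun _ _ => abs_nonneg _)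
          (((hk.1 n).2.1 x).trans (hRB n hn x))
    _ = ENNReal.ofReal ((ξ * ∫ x, |g x|) ^ n) := by
        rw [integral_mul_const, integral_fintype_prod_volume_eq_pow (fun x => |g x|),
          Fintype.card_fin, mul_pow, mul_comm]

lemma abs_le_exp_mul_abs_exp_sub_one {y C : ℝ} (hy : |y| ≤ C) :
    |y| ≤ Real.exp C * |Real.exp y - 1| := by
  rcases le_total 0 y with h | h
  · have h1 := Real.add_one_le_exp y
    have h2 : 1 ≤ Real.exp C := Real.one_le_exp ((abs_nonneg y).trans hy)
    rw [abs_of_nonneg h, abs_of_nonneg (by linarith)]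
    nlinarith
  · have h1 := Real.add_one_le_exp (-y)
    have h2 : Real.exp (-y) ≤ Real.exp C := Real.exp_le_exp.2 (by rwa [abs_of_nonpos h] at hy)
    have h3 : Real.exp y ≤ 1 := Real.exp_le_one_iff.2 h
    have h4 : Real.exp (-y) * Real.exp y = 1 := by rw [← Real.exp_add]; simp
    rw [abs_of_nonpos h, abs_of_nonpos (by linarith)]
    nlinarith

lemma Config.summable_abs_of_exp_sub_one {d : ℕ} (γ : Config d) {f : EucSp d → ℝ}
    {Λ : Set (EucSp d)} {C : ℝ} (hΛ : IsCompact Λ) (hC : ∀ x ∉ Λ, |f x| ≤ C)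
    (hs : Summable fun x : γ.1 => |Real.exp (f x) - 1|) : Summable fun x : γ.1 => |f x| := by
  refine Summable.of_norm_bounded_eventually (hs.mul_left (Real.exp C)) ?_
  have hfin : {x : γ.1 | x.1 ∈ Λ}.Finite := by
    refine Finite.of_finite_image ((γ.2 Λ hΛ).subset ?_) Subtype.val_injective.injOn
    rintro _ ⟨x, hx, rfl⟩
    exact ⟨x.2, hx⟩
  filter_upwards [hfin.compl_mem_cofinite] with x hx
  rw [Real.norm_eq_abs, abs_abs]
  exact abs_le_exp_mul_abs_exp_sub_one (hC _ hx)

lemma exp_tsum_eq_tsum_finset_prod {ι : Type*} {f : ι → ℝ} (hf : Summable f)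
    (hs : Summable fun s : Finset ι => ∏ i ∈ s, (Real.exp (f i) - 1)) :
    Real.exp (∑' i, f i) = ∑' s : Finset ι, ∏ i ∈ s, (Real.exp (f i) - 1) := by
  rw [← tprod_one_add hs]
  simp only [add_sub_cancel]
  exact hf.hasSum.rexp.tprod_eq.symm

/-- If `μ` has correlation functions satisfying the Ruelle bound and
`f` is measurable, bounded outside a compact set, with `e^f - 1 ∈ L¹`, then
`⟨|f|,γ⟩ < ∞` for `μ`-a.a. `γ` and
`∫_Γ e^{⟨f,γ⟩} dμ = 1 + ∑_{n≥1} (1/n!) ∫ (e^{f(x₁)}-1)⋯(e^{f(xₙ)}-1) kₙ dx`,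
both sides being finite. -/
theorem statement0 (d : ℕ) (hd : 0 < d) (μ : Measure (Config d)) [IsProbabilityMeasure μ]
    (k : ∀ n : ℕ, (Fin n → EucSp d) → ℝ) (hk : HasCorrFns μ k)
    (ξ : ℝ) (hξ : 0 < ξ) (hRB : RuelleBound k ξ)
    (f : EucSp d → ℝ) (hfm : Measurable f)
    (hfb : ∃ (Λ : Set (EucSp d)) (C : ℝ), IsCompact Λ ∧ ∀ x ∉ Λ, |f x| ≤ C)
    (hfi : Integrable (fun x => Real.exp (f x) - 1) volume) :
    (∀ᵐ γ ∂μ, Summable (fun x : γ.1 => |f x.1|)) ∧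
    Integrable (fun γ : Config d => Real.exp (cpair f γ)) μ ∧
    (∀ n : ℕ, Integrable (fun x : Fin (n + 1) → EucSp d =>
        (∏ i, (Real.exp (f (x i)) - 1)) * k (n + 1) x) volume) ∧
    Summable (fun n : ℕ => (((n + 1).factorial : ℝ))⁻¹ *
        ∫ x : Fin (n + 1) → EucSp d, (∏ i, (Real.exp (f (x i)) - 1)) * k (n + 1) x) ∧
    ∫ γ, Real.exp (cpair f γ) ∂μ
      = 1 + ∑' n : ℕ, (((n + 1).factorial : ℝ))⁻¹ *
          ∫ x : Fin (n + 1) → EucSp d, (∏ i, (Real.exp (f (x i)) - 1)) * k (n + 1) x := by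
  obtain ⟨Λ, C, hΛ, hC⟩ := hfb
  set g : EucSp d → ℝ := fun x => Real.exp (f x) - 1
  have hg : Measurable g := (Real.measurable_exp.comp hfm).sub_const 1
  let S : (ℝ → ℝ≥0∞) → Config d → ℝ≥0∞ := fun φ γ => ∑' s : Finset γ.1, φ (∏ x ∈ s, g x)
  let pos : ℝ → ℝ≥0∞ := fun t => ENNReal.ofReal t
  let neg : ℝ → ℝ≥0∞ := fun t => ENNReal.ofReal (-t)
  have hpos : Measurable pos := ENNReal.measurable_ofReal
  have hneg : Measurable neg := ENNReal.measurable_ofReal.comp measurable_neg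
  have hS : ∀ {φ}, Measurable φ → Measurable (S φ) := measurable_tsum_finset_prod hg
  have hfinA : ∫⁻ γ, S (‖·‖ₑ) γ ∂μ ≠ ⊤ := by
    rw [hk.lintegral_tsum_finset_prod hg measurable_enorm]
    refine ENNReal.add_ne_top.2 ⟨enorm_ne_top, ?_⟩
    have hsum : Summable fun n : ℕ => (ξ * ∫ x, |g x|) ^ (n + 1) / (n + 1).factorial :=
      (summable_nat_add_iff 1).2 (Real.summable_pow_div_factorial _)
    refine ne_top_of_le_ne_top hsum.tsum_ofReal_ne_top (ENNReal.tsum_le_tsum fun n => ?_)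
    rw [ENNReal.ofReal_div_of_pos (by positivity), ENNReal.ofReal_natCast, div_eq_mul_inv, mul_comm]
    gcongr
    exact lintegral_prod_mul_corr_le hk hRB hfi n.succ_pos
  have hfin : ∀ {φ : ℝ → ℝ≥0∞}, (∀ t, φ t ≤ ‖t‖ₑ) → ∫⁻ γ, S φ γ ∂μ ≠ ⊤ := fun hφ =>
    ne_top_of_le_ne_top hfinA (lintegral_mono fun γ => ENNReal.tsum_le_tsum fun s => hφ _)
  have hposfin := hfin (φ := pos) fun t => Real.ofReal_le_enorm t
  have hnegfin := hfin (φ := neg) fun t => (Real.ofReal_le_enorm (-t)).trans_eq (enorm_neg t)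
  have hprod : ∀ᵐ γ ∂μ, Summable fun s : Finset γ.1 => |∏ x ∈ s, g x| := by
    filter_upwards [ae_lt_top (hS measurable_enorm) hfinA] with γ hγ
    exact (ENNReal.summable_toReal hγ.ne).congr fun s => toReal_enorm _
  have hsum : ∀ᵐ γ ∂μ, Summable fun x : γ.1 => |f x.1| := by
    filter_upwards [hprod] with γ hγ
    refine γ.summable_abs_of_exp_sub_one hΛ hC ?_
    exact (hγ.comp_injective (Finset.singleton_injective (α := γ.1))).congr fun x => by simp [g]
  have hexp : (fun γ => Real.exp (cpair f γ))
      =ᵐ[μ] fun γ => (S pos γ).toReal - (S neg γ).toReal := by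
    filter_upwards [hprod, hsum] with γ h1 h2
    rw [cpair, exp_tsum_eq_tsum_finset_prod h2.of_abs h1.of_abs, tsum_eq_toReal_tsum_sub h1.of_abs]
  have hintpos : Integrable (fun γ => (S pos γ).toReal) μ :=
    integrable_toReal_of_lintegral_ne_top (hS hpos).aemeasurable hposfin
  have hintneg : Integrable (fun γ => (S neg γ).toReal) μ :=
    integrable_toReal_of_lintegral_ne_top (hS hneg).aemeasurable hnegfin
  have hint : ∀ n : ℕ, Integrable (fun x : Fin (n + 1) → EucSp d =>
      (∏ i, g (x i)) * k (n + 1) x) volume :=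
    fun n => integrable_prod_mul_corr hk hRB hfi n.succ_pos
  let T : (ℝ → ℝ≥0∞) → ℕ → ℝ≥0∞ := fun φ n => (((n + 1).factorial : ℝ≥0∞))⁻¹ *
    ∫⁻ x : Fin (n + 1) → EucSp d, φ (∏ i, g (x i)) * ENNReal.ofReal (k (n + 1) x)
  have hST : ∀ {φ}, Measurable φ → ∫⁻ γ, S φ γ ∂μ = φ 1 + ∑' n, T φ n :=
    fun hφ => hk.lintegral_tsum_finset_prod hg hφ
  have hTpos : ∑' n, T pos n ≠ ⊤ := (ENNReal.add_ne_top.1 (hST hpos ▸ hposfin)).2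
  have hTneg : ∑' n, T neg n ≠ ⊤ := (ENNReal.add_ne_top.1 (hST hneg ▸ hnegfin)).2
  have hterm : ∀ n : ℕ, (((n + 1).factorial : ℝ))⁻¹ *
      ∫ x : Fin (n + 1) → EucSp d, (∏ i, g (x i)) * k (n + 1) x
        = (T pos n).toReal - (T neg n).toReal := by
    intro n
    rw [integral_eq_lintegral_pos_part_sub_lintegral_neg_part (hint n)]
    simp only [T, pos, neg, ENNReal.toReal_mul, ENNReal.toReal_inv, ENNReal.toReal_natCast, mul_sub,
      ← neg_mul, ENNReal.ofReal_mul' ((hk.1 (n + 1)).2.1 _)]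
  have hsumpos := ENNReal.summable_toReal hTpos
  have hsumneg := ENNReal.summable_toReal hTneg
  refine ⟨hsum, (hintpos.sub hintneg).congr hexp.symm, hint,
    (hsumpos.sub hsumneg).congr fun n => (hterm n).symm, ?_⟩
  rw [integral_congr_ae hexp, integral_sub hintpos hintneg,
    integral_toReal (hS hpos).aemeasurable (ae_lt_top (hS hpos) hposfin),
    integral_toReal (hS hneg).aemeasurable (ae_lt_top (hS hneg) hnegfin), hST hpos, hST hneg,
    tsum_congr hterm, hsumpos.tsum_sub hsumneg, ENNReal.toReal_add (by simp [pos]) hTpos,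
    ENNReal.toReal_add (by simp [neg]) hTneg,
    ENNReal.tsum_toReal_eq (ENNReal.ne_top_of_tsum_ne_top hTpos),
    ENNReal.tsum_toReal_eq (ENNReal.ne_top_of_tsum_ne_top hTneg)]
  simp [pos, neg, add_sub_assoc, ENNReal.toReal_ofReal']

end
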